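/- Let V be a simple 𝔤₀-supermodule. Then every non-zero 𝔤-submodule of K(V) contains Λ^max(𝔤₋₁) ⊗ V; in particular, the socle of K(V) equals U(𝔤)·(Λ^max(𝔤₋₁) ⊗ V) and is a simple 𝔤-supermodule. Similarly, the opposite Kac module K'(V) has simple socle. In particular, both K(V) and K'(V) are indecomposable 𝔤-supermodules. -/

import Mathlib

noncomputable section

open Module Function

/-- A complex Lie superalgebra `𝔤 = 𝔤₀̄ ⊕ 𝔤₁̄` equipped with a compatible `ℤ`-grading
`𝔤 = 𝔤₋₁ ⊕ 𝔤₀ ⊕ 𝔤₁`, i.e. `𝔤₀ = 𝔤₀̄`, `𝔤₁̄ = 𝔤₁ ⊕ 𝔤₋₁`, the pieces `𝔤±₁` are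
`𝔤₀̄`-submodules and `[𝔤₁,𝔤₁] = [𝔤₋₁,𝔤₋₁] = 0`.  The super skew-symmetry and the super
Jacobi identity are imposed on (parity-)homogeneous elements, as usual. -/
structure GLSA where
  carrier : Type
  [isACG : AddCommGroup carrier]
  [isMod : Module ℂ carrier]
  bracket : carrier →ₗ[ℂ] carrier →ₗ[ℂ] carrier
  gneg : Submodule ℂ carrier
  g0 : Submodule ℂ carrier
  gpos : Submodule ℂ carrier
  oddCompl : IsCompl g0 (gneg ⊔ gpos)
  disjNP : Disjoint gneg gpos
  br_00 : ∀ x ∈ g0, ∀ y ∈ g0, bracket x y ∈ g0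
  br_0p : ∀ x ∈ g0, ∀ y ∈ gpos, bracket x y ∈ gpos
  br_0n : ∀ x ∈ g0, ∀ y ∈ gneg, bracket x y ∈ gneg
  br_pn : ∀ x ∈ gpos, ∀ y ∈ gneg, bracket x y ∈ g0
  br_pp : ∀ x ∈ gpos, ∀ y ∈ gpos, bracket x y = 0
  br_nn : ∀ x ∈ gneg, ∀ y ∈ gneg, bracket x y = 0
  skew_e : ∀ x ∈ g0, ∀ y, bracket x y = - bracket y x
  skew_oo : ∀ x ∈ gneg ⊔ gpos, ∀ y ∈ gneg ⊔ gpos, bracket x y = bracket y x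
  jacobi_e : ∀ x y z : carrier, (x ∈ g0 ∨ y ∈ g0) →
    bracket x (bracket y z) = bracket (bracket x y) z + bracket y (bracket x z)
  jacobi_oo : ∀ x ∈ gneg ⊔ gpos, ∀ y ∈ gneg ⊔ gpos, ∀ z,
    bracket x (bracket y z) = bracket (bracket x y) z - bracket y (bracket x z)

attribute [instance] GLSA.isACG GLSA.isMod

/-- The odd part `𝔤₁̄ = 𝔤₋₁ ⊕ 𝔤₁` of `L`. -/
def GLSA.odd (L : GLSA) : Submodule ℂ L.carrier := L.gneg ⊔ L.gpos

/-- A `𝔤`-supermodule: a `ℤ₂`-graded complex vector space with a compatible action of the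
Lie superalgebra `L` (signs in the compatibility with the bracket are imposed on
homogeneous elements). -/
structure SMod (L : GLSA) where
  carrier : Type
  [isACG : AddCommGroup carrier]
  [isMod : Module ℂ carrier]
  act : L.carrier →ₗ[ℂ] carrier →ₗ[ℂ] carrier
  ev : Submodule ℂ carrier
  od : Submodule ℂ carrier
  grading : IsCompl ev od
  act_e_ev : ∀ x ∈ L.g0, ∀ m ∈ ev, act x m ∈ ev
  act_e_od : ∀ x ∈ L.g0, ∀ m ∈ od, act x m ∈ od
  act_o_ev : ∀ x ∈ L.odd, ∀ m ∈ ev, act x m ∈ od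
  act_o_od : ∀ x ∈ L.odd, ∀ m ∈ od, act x m ∈ ev
  act_br_e : ∀ x y : L.carrier, (x ∈ L.g0 ∨ y ∈ L.g0) → ∀ m,
    act (L.bracket x y) m = act x (act y m) - act y (act x m)
  act_br_oo : ∀ x ∈ L.odd, ∀ y ∈ L.odd, ∀ m,
    act (L.bracket x y) m = act x (act y m) + act y (act x m)

attribute [instance] SMod.isACG SMod.isMod

/-- A `𝔤₀̄`-supermodule: a `ℤ₂`-graded complex vector space with an action of the (purely
even) Lie algebra `𝔤₀̄ = 𝔤₀` preserving the grading. -/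
structure SMod0 (L : GLSA) where
  carrier : Type
  [isACG : AddCommGroup carrier]
  [isMod : Module ℂ carrier]
  act : ↥L.g0 →ₗ[ℂ] carrier →ₗ[ℂ] carrier
  ev : Submodule ℂ carrier
  od : Submodule ℂ carrier
  grading : IsCompl ev od
  act_ev : ∀ (x : L.g0), ∀ m ∈ ev, act x m ∈ ev
  act_od : ∀ (x : L.g0), ∀ m ∈ od, act x m ∈ od
  act_br : ∀ (x y : L.g0) (m : carrier),
    act ⟨L.bracket ↑x ↑y, L.br_00 ↑x x.2 ↑y y.2⟩ m = act x (act y m) - act y (act x m)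

attribute [instance] SMod0.isACG SMod0.isMod

/-- A homomorphism of `𝔤`-supermodules (homogeneous of degree zero). -/
structure SHom {L : GLSA} (M N : SMod L) where
  toLin : M.carrier →ₗ[ℂ] N.carrier
  map_ev : ∀ m ∈ M.ev, toLin m ∈ N.ev
  map_od : ∀ m ∈ M.od, toLin m ∈ N.od
  equivar : ∀ (x : L.carrier) (m : M.carrier), toLin (M.act x m) = N.act x (toLin m)

/-- Isomorphism of `𝔤`-supermodules. -/
def SIso {L : GLSA} (M N : SMod L) : Prop := ∃ f : SHom M N, Bijective f.toLin

/-- Isomorphism of `𝔤₀̄`-supermodules. -/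
def SIso0 {L : GLSA} (V W : SMod0 L) : Prop :=
  ∃ e : V.carrier ≃ₗ[ℂ] W.carrier,
    (∀ v ∈ V.ev, e v ∈ W.ev) ∧ (∀ v ∈ V.od, e v ∈ W.od) ∧
    (∀ (x : L.g0) (v : V.carrier), e (V.act x v) = W.act x (e v))

/-- Isomorphism of `𝔤`-supermodules up to parity change. -/
def SIsoUpToParity {L : GLSA} (M N : SMod L) : Prop :=
  ∃ e : M.carrier ≃ₗ[ℂ] N.carrier,
    (∀ (x : L.carrier) (m : M.carrier), e (M.act x m) = N.act x (e m)) ∧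
    (((∀ m ∈ M.ev, e m ∈ N.ev) ∧ (∀ m ∈ M.od, e m ∈ N.od)) ∨
     ((∀ m ∈ M.ev, e m ∈ N.od) ∧ (∀ m ∈ M.od, e m ∈ N.ev)))

namespace SMod

variable {L : GLSA}

/-- A (graded) sub-supermodule of a `𝔤`-supermodule. -/
def IsSubmod (M : SMod L) (N : Submodule ℂ M.carrier) : Prop :=
  (∀ (x : L.carrier), ∀ m ∈ N, M.act x m ∈ N) ∧ N ≤ (N ⊓ M.ev) ⊔ (N ⊓ M.od)

/-- A simple sub-supermodule. -/
def IsSimpleSub (M : SMod L) (N : Submodule ℂ M.carrier) : Prop :=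
  M.IsSubmod N ∧ N ≠ ⊥ ∧ ∀ N', M.IsSubmod N' → N' ≤ N → N' = ⊥ ∨ N' = N

/-- The socle: the sum of all simple sub-supermodules. -/
def socle (M : SMod L) : Submodule ℂ M.carrier := sSup {N | M.IsSimpleSub N}

/-- The sub-supermodule generated by a subspace, i.e. `U(𝔤)·S`. -/
def gen (M : SMod L) (S : Submodule ℂ M.carrier) : Submodule ℂ M.carrier :=
  sInf {N | M.IsSubmod N ∧ S ≤ N}

/-- Simplicity of a `𝔤`-supermodule. -/
def IsSimple (M : SMod L) : Prop :=
  (⊤ : Submodule ℂ M.carrier) ≠ ⊥ ∧ ∀ N, M.IsSubmod N → N = ⊥ ∨ N = ⊤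

/-- Indecomposability of a `𝔤`-supermodule. -/
def Indecomposable (M : SMod L) : Prop :=
  (⊤ : Submodule ℂ M.carrier) ≠ ⊥ ∧
  ∀ N₁ N₂, M.IsSubmod N₁ → M.IsSubmod N₂ → N₁ ⊓ N₂ = ⊥ → N₁ ⊔ N₂ = ⊤ →
    N₁ = ⊥ ∨ N₂ = ⊥

/-- The parity change functor `Π`. -/
def pshift (M : SMod L) : SMod L where
  carrier := M.carrier
  act := M.act
  ev := M.od
  od := M.ev
  grading := M.grading.symm
  act_e_ev := M.act_e_od
  act_e_od := M.act_e_ev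
  act_o_ev := M.act_o_od
  act_o_od := M.act_o_ev
  act_br_e := M.act_br_e
  act_br_oo := M.act_br_oo

/-- The space `M^{𝔤₁}` of `𝔤₁`-invariants. -/
def invPos (M : SMod L) : Submodule ℂ M.carrier where
  carrier := {m | ∀ x ∈ L.gpos, M.act x m = 0}
  add_mem' := by
    intro a b ha hb x hx
    rw [map_add, ha x hx, hb x hx, add_zero]
  zero_mem' := by intro x hx; simp
  smul_mem' := by
    intro c a ha x hx
    rw [map_smul, ha x hx, smul_zero]

/-- The space `M^{𝔤₋₁}` of `𝔤₋₁`-invariants. -/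
def invNeg (M : SMod L) : Submodule ℂ M.carrier where
  carrier := {m | ∀ x ∈ L.gneg, M.act x m = 0}
  add_mem' := by
    intro a b ha hb x hx
    rw [map_add, ha x hx, hb x hx, add_zero]
  zero_mem' := by intro x hx; simp
  smul_mem' := by
    intro c a ha x hx
    rw [map_smul, ha x hx, smul_zero]

/-- Iterated action of a list of elements of `𝔤`. -/
def actList (M : SMod L) : List L.carrier → M.carrier → M.carrier
  | [], m => m
  | x :: xs, m => M.act x (M.actList xs m)

end SMod

namespace SMod0

variable {L : GLSA}

/-- A (graded) sub-supermodule of a `𝔤₀̄`-supermodule. -/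
def IsSubmod (V : SMod0 L) (N : Submodule ℂ V.carrier) : Prop :=
  (∀ (x : L.g0), ∀ v ∈ N, V.act x v ∈ N) ∧ N ≤ (N ⊓ V.ev) ⊔ (N ⊓ V.od)

/-- Simplicity of a `𝔤₀̄`-supermodule. -/
def IsSimple (V : SMod0 L) : Prop :=
  (⊤ : Submodule ℂ V.carrier) ≠ ⊥ ∧ ∀ N, V.IsSubmod N → N = ⊥ ∨ N = ⊤

end SMod0

/-- `IsKac V K η` expresses that `K`, together with the (even, `𝔤₀̄`-equivariant) unit map
`η : V → K` whose image is annihilated by `𝔤₁`, is *the* Kac module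
`K(V) = Ind_{𝔤≥0}^{𝔤} V` of the `𝔤₀̄`-supermodule `V` (on which `𝔤₁` acts by zero), i.e.
satisfies the universal property `Hom_𝔤(K(V), M) = Hom_{𝔤₀̄}(V, M^{𝔤₁})`. -/
structure IsKac {L : GLSA} (V : SMod0 L) (K : SMod L) (η : V.carrier →ₗ[ℂ] K.carrier) : Prop where
  map_ev : ∀ v ∈ V.ev, η v ∈ K.ev
  map_od : ∀ v ∈ V.od, η v ∈ K.od
  equivar : ∀ (x : L.g0) (v : V.carrier), η (V.act x v) = K.act ↑x (η v)
  pos_zero : ∀ x ∈ L.gpos, ∀ v : V.carrier, K.act x (η v) = 0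
  injective : Injective η
  generates : K.gen (LinearMap.range η) = ⊤
  universal : ∀ (M : SMod L) (φ : V.carrier →ₗ[ℂ] M.carrier),
    (∀ v ∈ V.ev, φ v ∈ M.ev) → (∀ v ∈ V.od, φ v ∈ M.od) →
    (∀ (x : L.g0) (v : V.carrier), φ (V.act x v) = M.act ↑x (φ v)) →
    (∀ x ∈ L.gpos, ∀ v : V.carrier, M.act x (φ v) = 0) →
    ∃! Φ : SHom K M, ∀ v, Φ.toLin (η v) = φ v

/-- The opposite Kac module `K'(V) = Ind_{𝔤≤0}^{𝔤} V` (with `𝔤₋₁` acting by zero on `V`),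
described by its universal property. -/
structure IsKac' {L : GLSA} (V : SMod0 L) (K : SMod L) (η : V.carrier →ₗ[ℂ] K.carrier) : Prop where
  map_ev : ∀ v ∈ V.ev, η v ∈ K.ev
  map_od : ∀ v ∈ V.od, η v ∈ K.od
  equivar : ∀ (x : L.g0) (v : V.carrier), η (V.act x v) = K.act ↑x (η v)
  neg_zero : ∀ x ∈ L.gneg, ∀ v : V.carrier, K.act x (η v) = 0
  injective : Injective η
  generates : K.gen (LinearMap.range η) = ⊤
  universal : ∀ (M : SMod L) (φ : V.carrier →ₗ[ℂ] M.carrier),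
    (∀ v ∈ V.ev, φ v ∈ M.ev) → (∀ v ∈ V.od, φ v ∈ M.od) →
    (∀ (x : L.g0) (v : V.carrier), φ (V.act x v) = M.act ↑x (φ v)) →
    (∀ x ∈ L.gneg, ∀ v : V.carrier, M.act x (φ v) = 0) →
    ∃! Φ : SHom K M, ∀ v, Φ.toLin (η v) = φ v

/-- `IsCoindPos W C ε` expresses that `C`, together with the (even, `𝔤₀̄`-equivariant)
counit `ε : C → W` killing `𝔤₁·C`, is the coinduced module `Coind_{𝔤≥0}^{𝔤}(W)` of the
`𝔤₀̄`-supermodule `W` (with `𝔤₁` acting by zero), i.e. satisfies the universal property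
`Hom_𝔤(M, Coind(W)) = Hom_{𝔤≥0}(Res M, W)`. -/
structure IsCoindPos {L : GLSA} (W : SMod0 L) (C : SMod L) (ε : C.carrier →ₗ[ℂ] W.carrier) : Prop where
  map_ev : ∀ c ∈ C.ev, ε c ∈ W.ev
  map_od : ∀ c ∈ C.od, ε c ∈ W.od
  equivar : ∀ (x : L.g0) (c : C.carrier), ε (C.act ↑x c) = W.act x (ε c)
  pos_zero : ∀ x ∈ L.gpos, ∀ c : C.carrier, ε (C.act x c) = 0
  universal : ∀ (M : SMod L) (ψ : M.carrier →ₗ[ℂ] W.carrier),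
    (∀ m ∈ M.ev, ψ m ∈ W.ev) → (∀ m ∈ M.od, ψ m ∈ W.od) →
    (∀ (x : L.g0) (m : M.carrier), ψ (M.act ↑x m) = W.act x (ψ m)) →
    (∀ x ∈ L.gpos, ∀ m : M.carrier, ψ (M.act x m) = 0) →
    ∃! Φ : SHom M C, ∀ m, ε (Φ.toLin m) = ψ m

/-- `Coind_{𝔤≤0}^{𝔤}(W)`, by its universal property. -/
structure IsCoindNeg {L : GLSA} (W : SMod0 L) (C : SMod L) (ε : C.carrier →ₗ[ℂ] W.carrier) : Prop where
  map_ev : ∀ c ∈ C.ev, ε c ∈ W.ev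
  map_od : ∀ c ∈ C.od, ε c ∈ W.od
  equivar : ∀ (x : L.g0) (c : C.carrier), ε (C.act ↑x c) = W.act x (ε c)
  neg_zero : ∀ x ∈ L.gneg, ∀ c : C.carrier, ε (C.act x c) = 0
  universal : ∀ (M : SMod L) (ψ : M.carrier →ₗ[ℂ] W.carrier),
    (∀ m ∈ M.ev, ψ m ∈ W.ev) → (∀ m ∈ M.od, ψ m ∈ W.od) →
    (∀ (x : L.g0) (m : M.carrier), ψ (M.act ↑x m) = W.act x (ψ m)) →
    (∀ x ∈ L.gneg, ∀ m : M.carrier, ψ (M.act x m) = 0) →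
    ∃! Φ : SHom M C, ∀ m, ε (Φ.toLin m) = ψ m

/-- The subspace `Λ^max(𝔤₋₁) ⊗ V ⊆ K(V)`: the span of all elements obtained by acting on
`η(V)` with `dim 𝔤₋₁` many elements of `𝔤₋₁`. -/
def botPartNeg {L : GLSA} (V : SMod0 L) (K : SMod L) (η : V.carrier →ₗ[ℂ] K.carrier) :
    Submodule ℂ K.carrier :=
  Submodule.span ℂ {m | ∃ (xs : List L.carrier) (v : V.carrier),
    xs.length = finrank ℂ ↥L.gneg ∧ (∀ x ∈ xs, x ∈ L.gneg) ∧ m = K.actList xs (η v)}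

/-- The subspace `Λ^max(𝔤₁) ⊗ V ⊆ K'(V)`. -/
def botPartPos {L : GLSA} (V : SMod0 L) (K : SMod L) (η : V.carrier →ₗ[ℂ] K.carrier) :
    Submodule ℂ K.carrier :=
  Submodule.span ℂ {m | ∃ (xs : List L.carrier) (v : V.carrier),
    xs.length = finrank ℂ ↥L.gpos ∧ (∀ x ∈ xs, x ∈ L.gpos) ∧ m = K.actList xs (η v)}

/-- For `x ∈ 𝔤₀̄`, the operator `ad x` restricted to `𝔤₁`. -/
def adPos (L : GLSA) (x : L.g0) : ↥L.gpos →ₗ[ℂ] ↥L.gpos :=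
  (L.bracket ↑x).restrict (fun y hy => L.br_0p ↑x x.2 y hy)

/-- For `x ∈ 𝔤₀̄`, the operator `ad x` restricted to `𝔤₋₁`. -/
def adNeg (L : GLSA) (x : L.g0) : ↥L.gneg →ₗ[ℂ] ↥L.gneg :=
  (L.bracket ↑x).restrict (fun y hy => L.br_0n ↑x x.2 y hy)

/-- The character by which `𝔤₀̄` acts on the one-dimensional module `Λ^max(𝔤₁)`. -/
def traceCharPos (L : GLSA) (x : L.g0) : ℂ := LinearMap.trace ℂ ↥L.gpos (adPos L x)

/-- The character by which `𝔤₀̄` acts on the one-dimensional module `Λ^max(𝔤₋₁)`. -/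
def traceCharNeg (L : GLSA) (x : L.g0) : ℂ := LinearMap.trace ℂ ↥L.gneg (adNeg L x)

/-- `IsTwistBy V W χ swap` expresses that `W ≅ ℂ_χ ⊗ V` as `𝔤₀̄`-supermodules, where `ℂ_χ`
is the one-dimensional module with character `χ`, of odd parity iff `swap = true`.
Taking `χ` to be `traceCharPos`/`traceCharNeg` (resp. their negatives) and `swap` the parity
of `dim 𝔤±₁` expresses `W ≅ Λ^max(𝔤±₁) ⊗ V` (resp. `W ≅ Λ^max(𝔤±₁^*) ⊗ V`). -/
def IsTwistBy {L : GLSA} (V W : SMod0 L) (χ : ↥L.g0 → ℂ) (swap : Bool) : Prop :=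
  ∃ e : V.carrier ≃ₗ[ℂ] W.carrier,
    (∀ (x : L.g0) (v : V.carrier), W.act x (e v) = e (V.act x v) + χ x • e v) ∧
    (if swap then (∀ v ∈ V.ev, e v ∈ W.od) ∧ (∀ v ∈ V.od, e v ∈ W.ev)
     else (∀ v ∈ V.ev, e v ∈ W.ev) ∧ (∀ v ∈ V.od, e v ∈ W.od))

/-- Parity (as a `Bool`) of `dim 𝔤₁`. -/
def parPos (L : GLSA) : Bool := (finrank ℂ ↥L.gpos) % 2 == 1

/-- Parity (as a `Bool`) of `dim 𝔤₋₁`. -/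
def parNeg (L : GLSA) : Bool := (finrank ℂ ↥L.gneg) % 2 == 1

section Parity

variable {E F : Type*} [AddCommGroup E] [Module ℂ E] [AddCommGroup F] [Module ℂ F]

theorem eq_zero_of_eq_neg {a : E} (h : a = -a) : a = 0 := by
  have h2 : (2 : ℂ) • a = 0 := by rw [two_smul]; nth_rewrite 2 [h]; exact add_neg_cancel a
  simpa using h2

/-- The parity involution of a `ℤ₂`-graded space: `1` on the even part, `-1` on the odd part. -/
def parityMap {ev od : Submodule ℂ E} (h : IsCompl ev od) : E →ₗ[ℂ] E :=
  ev.projection od h - od.projection ev h.symm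

variable {ev od : Submodule ℂ E} (h : IsCompl ev od)

theorem parityMap_of_mem_ev {m : E} (hm : m ∈ ev) : parityMap h m = m := by
  simp [parityMap, Submodule.projection_apply_of_mem_left h hm,
    Submodule.projection_apply_of_mem_right h.symm hm]

theorem parityMap_of_mem_od {m : E} (hm : m ∈ od) : parityMap h m = -m := by
  simp [parityMap, Submodule.projection_apply_of_mem_left h.symm hm,
    Submodule.projection_apply_of_mem_right h hm]

theorem exists_ev_add_od {ev od : Submodule ℂ E} (h : IsCompl ev od) (m : E) :
    ∃ a ∈ ev, ∃ b ∈ od, m = a + b := by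
  have hm : m ∈ ev ⊔ od := h.sup_eq_top ▸ Submodule.mem_top
  obtain ⟨a, ha, b, hb, rfl⟩ := Submodule.mem_sup.1 hm
  exact ⟨a, ha, b, hb, rfl⟩

theorem parityMap_parityMap (m : E) : parityMap h (parityMap h m) = m := by
  obtain ⟨a, ha, b, hb, rfl⟩ := exists_ev_add_od h m
  simp [parityMap_of_mem_ev h ha, parityMap_of_mem_od h hb]

theorem mem_ev_of_parityMap_eq {m : E} (hm : parityMap h m = m) : m ∈ ev := by
  obtain ⟨a, ha, b, hb, rfl⟩ := exists_ev_add_od h m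
  simp only [map_add, parityMap_of_mem_ev h ha, parityMap_of_mem_od h hb] at hm
  have hb0 : b = 0 := eq_zero_of_eq_neg (add_left_cancel hm).symm
  simpa [hb0] using ha

theorem mem_od_of_parityMap_eq_neg {m : E} (hm : parityMap h m = -m) : m ∈ od := by
  obtain ⟨a, ha, b, hb, rfl⟩ := exists_ev_add_od h m
  simp only [map_add, parityMap_of_mem_ev h ha, parityMap_of_mem_od h hb, neg_add] at hm
  have ha0 : a = 0 := eq_zero_of_eq_neg (add_right_cancel hm)
  simpa [ha0] using hb

theorem le_inf_sup_inf_iff (N : Submodule ℂ E) :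
    N ≤ (N ⊓ ev) ⊔ (N ⊓ od) ↔ ∀ m ∈ N, parityMap h m ∈ N := by
  constructor
  · intro hN m hm
    obtain ⟨a, ha, b, hb, rfl⟩ := Submodule.mem_sup.1 (hN hm)
    rw [map_add, parityMap_of_mem_ev h ha.2, parityMap_of_mem_od h hb.2]
    exact N.add_mem ha.1 (N.neg_mem hb.1)
  · intro hN m hm
    refine Submodule.mem_sup.2 ⟨(2⁻¹ : ℂ) • (m + parityMap h m), ⟨?_, ?_⟩,
      (2⁻¹ : ℂ) • (m - parityMap h m), ⟨?_, ?_⟩, by module⟩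
    · exact N.smul_mem _ (N.add_mem hm (hN m hm))
    · apply mem_ev_of_parityMap_eq h
      rw [map_smul, map_add, parityMap_parityMap, add_comm]
    · exact N.smul_mem _ (N.sub_mem hm (hN m hm))
    · apply mem_od_of_parityMap_eq_neg h
      rw [map_smul, map_sub, parityMap_parityMap, ← smul_neg, neg_sub]

variable {ev' od' : Submodule ℂ F} (h' : IsCompl ev' od')

theorem map_parityMap (f : E →ₗ[ℂ] F) (he : ∀ m ∈ ev, f m ∈ ev') (ho : ∀ m ∈ od, f m ∈ od')
    (m : E) : f (parityMap h m) = parityMap h' (f m) := by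
  obtain ⟨a, ha, b, hb, rfl⟩ := exists_ev_add_od h m
  simp [parityMap_of_mem_ev h ha, parityMap_of_mem_od h hb, parityMap_of_mem_ev h' (he a ha),
    parityMap_of_mem_od h' (ho b hb)]

theorem map_parityMap_neg (f : E →ₗ[ℂ] F) (he : ∀ m ∈ ev, f m ∈ od') (ho : ∀ m ∈ od, f m ∈ ev')
    (m : E) : f (parityMap h m) = -parityMap h' (f m) := by
  obtain ⟨a, ha, b, hb, rfl⟩ := exists_ev_add_od h m
  simp [add_comm, parityMap_of_mem_ev h ha, parityMap_of_mem_od h hb,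
    parityMap_of_mem_od h' (he a ha), parityMap_of_mem_ev h' (ho b hb)]

/-- The eigenspaces of an involution are complementary. -/
theorem isCompl_ker_of_involution (P : E →ₗ[ℂ] E) (hP : ∀ m, P (P m) = m) :
    IsCompl (LinearMap.ker (P - LinearMap.id)) (LinearMap.ker (P + LinearMap.id)) := by
  constructor
  · rw [Submodule.disjoint_def]
    intro m h1 h2
    simp only [LinearMap.mem_ker, LinearMap.sub_apply, LinearMap.add_apply, LinearMap.id_apply,
      sub_eq_zero] at h1 h2
    rw [h1] at h2
    exact eq_zero_of_eq_neg (eq_neg_of_add_eq_zero_left h2)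
  · rw [codisjoint_iff, eq_top_iff]
    intro m _
    refine Submodule.mem_sup.2 ⟨(2⁻¹ : ℂ) • (m + P m), ?_, (2⁻¹ : ℂ) • (m - P m), ?_, by module⟩
    · simp [hP, add_comm]
    · simp [hP]

end Parity

section Wedge

open scoped TensorProduct

variable {G V E : Type*} [AddCommGroup G] [Module ℂ G] [AddCommGroup V] [Module ℂ V]
  [AddCommGroup E] [Module ℂ E]

/-- Left exterior multiplication on `Λ(G) ⊗ V`. -/
def wedge : G →ₗ[ℂ] ExteriorAlgebra ℂ G ⊗[ℂ] V →ₗ[ℂ] ExteriorAlgebra ℂ G ⊗[ℂ] V :=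
  LinearMap.rTensorHom V ∘ₗ LinearMap.mul ℂ (ExteriorAlgebra ℂ G) ∘ₗ ExteriorAlgebra.ι ℂ

theorem wedge_tmul (x : G) (a : ExteriorAlgebra ℂ G) (v : V) :
    wedge x (a ⊗ₜ[ℂ] v) = (ExteriorAlgebra.ι ℂ x * a) ⊗ₜ v := rfl

theorem wedge_self (x : G) (m : ExteriorAlgebra ℂ G ⊗[ℂ] V) : wedge x (wedge x m) = 0 := by
  induction m with
  | zero => simp
  | add a b ha hb => simp [ha, hb]
  | tmul a v => simp [wedge_tmul, ← mul_assoc]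

theorem anticomm_of_sq_zero {T : G →ₗ[ℂ] E →ₗ[ℂ] E} (hT : ∀ x e, T x (T x e) = 0) (x y : G)
    (e : E) : T x (T y e) = -T y (T x e) := by
  have h := hT (x + y) e
  simp only [map_add, LinearMap.add_apply, hT, zero_add, add_zero] at h
  exact eq_neg_of_add_eq_zero_right h

theorem wedge_anticomm (x y : G) (m : ExteriorAlgebra ℂ G ⊗[ℂ] V) :
    wedge x (wedge y m) = -wedge y (wedge x m) :=
  anticomm_of_sq_zero wedge_self x y m

theorem wedge_induction {p : ExteriorAlgebra ℂ G ⊗[ℂ] V → Prop}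
    (one : ∀ v, p (1 ⊗ₜ v)) (add : ∀ m m', p m → p m' → p (m + m'))
    (wedge : ∀ x m, p m → p (wedge x m)) (m : ExteriorAlgebra ℂ G ⊗[ℂ] V) : p m := by
  induction m with
  | zero => simpa using one 0
  | add a b ha hb => exact add a b ha hb
  | tmul a v =>
    induction a using CliffordAlgebra.left_induction with
    | algebraMap r =>
      simpa [Algebra.algebraMap_eq_smul_one, TensorProduct.smul_tmul] using one (r • v)
    | add a b ha hb => simpa [TensorProduct.add_tmul] using add _ _ ha hb
    | ι_mul a x ha => exact wedge x _ ha

/-- Linear maps out of `Λ(G) ⊗ V` can be defined by recursion, prescribing their commutation with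
exterior multiplication. -/
theorem exists_wedge_rec (T : G →ₗ[ℂ] E →ₗ[ℂ] E)
    (C : G →ₗ[ℂ] ExteriorAlgebra ℂ G ⊗[ℂ] V →ₗ[ℂ] E) (i : V →ₗ[ℂ] E)
    (hT : ∀ x e, T x (T x e) = 0) (hC : ∀ x m, C x (wedge x m) + T x (C x m) = 0) :
    ∃ D : ExteriorAlgebra ℂ G ⊗[ℂ] V →ₗ[ℂ] E, (∀ v, D (1 ⊗ₜ v) = i v) ∧
      ∀ x m, D (wedge x m) = C x m + T x (D m) := by
  let f : G →ₗ[ℂ] ExteriorAlgebra ℂ G × (V →ₗ[ℂ] E) →ₗ[ℂ] (V →ₗ[ℂ] E) :=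
    LinearMap.mk₂ ℂ (fun x q => C x ∘ₗ TensorProduct.mk ℂ _ V q.1 + T x ∘ₗ q.2)
      (fun x y q => by ext v; simp; abel) (fun c x q => by ext v; simp)
      (fun x q q' => by ext v; simp; abel)
      (fun c x q => by ext v; simp)
  have hf : ∀ x a F, f x (CliffordAlgebra.ι 0 x * a, f x (a, F)) =
      (0 : QuadraticForm ℂ G) x • F := by
    intro x a F
    ext v
    have h := hC x (a ⊗ₜ v)
    rw [wedge_tmul] at h
    simp only [f, LinearMap.mk₂_apply, LinearMap.add_apply, LinearMap.comp_apply,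
      TensorProduct.mk_apply, map_add, hT, add_zero]
    rw [show CliffordAlgebra.ι 0 x = ExteriorAlgebra.ι ℂ x from rfl, h]
    simp
  refine ⟨TensorProduct.lift (CliffordAlgebra.foldr' 0 f hf i), fun v => ?_, fun x m => ?_⟩
  · have := CliffordAlgebra.foldr'_algebraMap (Q := (0 : QuadraticForm ℂ G)) f hf i 1
    rw [map_one, one_smul] at this
    rw [TensorProduct.lift.tmul]
    exact LinearMap.congr_fun this v
  · induction m with
    | zero => simp
    | add a b ha hb => simp only [map_add, ha, hb]; abel
    | tmul a v =>
      rw [wedge_tmul, TensorProduct.lift.tmul, TensorProduct.lift.tmul]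
      exact LinearMap.congr_fun (CliffordAlgebra.foldr'_ι_mul 0 f hf i x a) v

theorem exists_wedge_rec_neg
    (C : G →ₗ[ℂ] ExteriorAlgebra ℂ G ⊗[ℂ] V →ₗ[ℂ] ExteriorAlgebra ℂ G ⊗[ℂ] V)
    (i : V →ₗ[ℂ] ExteriorAlgebra ℂ G ⊗[ℂ] V)
    (hC : ∀ x m, C x (wedge x m) = wedge x (C x m)) :
    ∃ D : ExteriorAlgebra ℂ G ⊗[ℂ] V →ₗ[ℂ] ExteriorAlgebra ℂ G ⊗[ℂ] V,
      (∀ v, D (1 ⊗ₜ v) = i v) ∧ ∀ x m, D (wedge x m) = C x m - wedge x (D m) := by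
  obtain ⟨D, h1, h2⟩ := exists_wedge_rec ((-1 : ℂ) • wedge) C i
    (fun x m => by simp [wedge_self]) (fun x m => by simp [hC])
  exact ⟨D, h1, fun x m => by simpa [sub_eq_add_neg] using h2 x m⟩

end Wedge

section Model

open scoped TensorProduct

variable {L : GLSA}

/-- For `y ∈ 𝔤₁`, the map `[y, ·] : 𝔤₋₁ → 𝔤₀`. -/
def bracketPosNeg (L : GLSA) (y : L.gpos) : L.gneg →ₗ[ℂ] L.g0 :=
  (L.bracket ↑y).restrict (fun x hx => L.br_pn ↑y y.2 x hx)

theorem bracket_sq_zero {x y : L.carrier} (hx : x ∈ L.gneg) (hy : y ∈ L.gpos) :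
    L.bracket (L.bracket y x) x = 0 := by
  have hx' : x ∈ L.gneg ⊔ L.gpos := Submodule.mem_sup_left hx
  have hy' : y ∈ L.gneg ⊔ L.gpos := Submodule.mem_sup_right hy
  have h := L.jacobi_oo x hx' x hx' y
  rw [L.br_nn x hx x hx, map_zero, LinearMap.zero_apply, zero_sub] at h
  rw [L.skew_e _ (L.br_pn y hy x hx), L.skew_oo y hy' x hx', eq_zero_of_eq_neg h, neg_zero]

/-- The vector space `Λ(𝔤₋₁) ⊗ V` underlying the Kac module of `V`. -/
abbrev KacSpace (V : SMod0 L) : Type := ExteriorAlgebra ℂ L.gneg ⊗[ℂ] V.carrier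

variable (V : SMod0 L)

theorem exists_actZero : ∃ H : L.g0 →ₗ[ℂ] KacSpace V →ₗ[ℂ] KacSpace V,
    (∀ h v, H h (1 ⊗ₜ v) = 1 ⊗ₜ V.act h v) ∧
    ∀ h x m, H h (wedge x m) = wedge (adNeg L h x) m + wedge x (H h m) := by
  have key : ∀ h : L.g0, ∃ D : KacSpace V →ₗ[ℂ] KacSpace V,
      (∀ v, D (1 ⊗ₜ v) = (TensorProduct.mk ℂ _ _ 1 ∘ₗ V.act h) v) ∧
      ∀ x m, D (wedge x m) = (wedge ∘ₗ adNeg L h) x m + wedge x (D m) := fun h =>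
    exists_wedge_rec wedge (wedge ∘ₗ adNeg L h) _ wedge_self fun x m => by
      rw [LinearMap.comp_apply, wedge_anticomm, neg_add_cancel]
  choose H H1 HX using key
  refine ⟨⟨⟨H, fun a b => ?_⟩, fun c a => ?_⟩, fun h v => H1 h v, fun h x m => HX h x m⟩
  · refine LinearMap.ext fun m => ?_
    induction m using wedge_induction with
    | one v => simp [H1, TensorProduct.tmul_add]
    | add m m' hm hm' => simp only [map_add, hm, hm']
    | wedge x m hm =>
      have e : adNeg L (a + b) x = adNeg L a x + adNeg L b x := by ext; simp [adNeg]
      simp only [LinearMap.add_apply, HX, LinearMap.comp_apply, e, map_add, hm]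
      abel
  · refine LinearMap.ext fun m => ?_
    induction m using wedge_induction with
    | one v => simp [H1]
    | add m m' hm hm' => simp only [map_add, hm, hm']
    | wedge x m hm =>
      have e : adNeg L (c • a) x = c • adNeg L a x := by ext; simp [adNeg]
      simp only [RingHom.id_apply, LinearMap.smul_apply] at hm ⊢
      simp only [HX, LinearMap.comp_apply, e, map_smul, hm, LinearMap.smul_apply, smul_add]

/-- The action of `𝔤₀` on `Λ(𝔤₋₁) ⊗ V`. -/
def actZero : L.g0 →ₗ[ℂ] KacSpace V →ₗ[ℂ] KacSpace V := (exists_actZero V).choose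

theorem actZero_one (h : L.g0) (v : V.carrier) :
    actZero V h (1 ⊗ₜ v) = 1 ⊗ₜ V.act h v := (exists_actZero V).choose_spec.1 h v

theorem actZero_wedge (h : L.g0) (x : L.gneg) (m : KacSpace V) :
    actZero V h (wedge x m) = wedge (adNeg L h x) m + wedge x (actZero V h m) :=
  (exists_actZero V).choose_spec.2 h x m

theorem exists_actPos : ∃ Y : L.gpos →ₗ[ℂ] KacSpace V →ₗ[ℂ] KacSpace V,
    (∀ y v, Y y (1 ⊗ₜ v) = 0) ∧
    ∀ y x m, Y y (wedge x m) = actZero V (bracketPosNeg L y x) m - wedge x (Y y m) := by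
  have key : ∀ y : L.gpos, ∃ D : KacSpace V →ₗ[ℂ] KacSpace V,
      (∀ v, D (1 ⊗ₜ v) = (0 : V.carrier →ₗ[ℂ] KacSpace V) v) ∧
      ∀ x m, D (wedge x m) =
        (actZero V ∘ₗ bracketPosNeg L y) x m - wedge x (D m) := fun y =>
    exists_wedge_rec_neg (actZero V ∘ₗ bracketPosNeg L y) _ fun x m => by
      have e : adNeg L (bracketPosNeg L y x) x = 0 := Subtype.ext (bracket_sq_zero x.2 y.2)
      simp [actZero_wedge, e]
  choose Y Y1 YX using key
  refine ⟨⟨⟨Y, fun a b => ?_⟩, fun c a => ?_⟩, fun h v => Y1 h v, fun h x m => YX h x m⟩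
  · refine LinearMap.ext fun m => ?_
    induction m using wedge_induction with
    | one v => simp [Y1]
    | add m m' hm hm' => simp only [map_add, hm, hm']
    | wedge x m hm =>
      have e : bracketPosNeg L (a + b) x = bracketPosNeg L a x + bracketPosNeg L b x := by
        ext; simp [bracketPosNeg]
      simp only [LinearMap.add_apply, YX, LinearMap.comp_apply, e, map_add, hm]
      abel
  · refine LinearMap.ext fun m => ?_
    induction m using wedge_induction with
    | one v => simp [Y1]
    | add m m' hm hm' => simp only [map_add, hm, hm']
    | wedge x m hm =>
      have e : bracketPosNeg L (c • a) x = c • bracketPosNeg L a x := by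
        ext; simp [bracketPosNeg]
      simp only [RingHom.id_apply, LinearMap.smul_apply] at hm ⊢
      simp only [YX, LinearMap.comp_apply, e, map_smul, hm, LinearMap.smul_apply, smul_sub]

/-- The action of `𝔤₁` on `Λ(𝔤₋₁) ⊗ V`. -/
def actPos : L.gpos →ₗ[ℂ] KacSpace V →ₗ[ℂ] KacSpace V := (exists_actPos V).choose

theorem actPos_one (y : L.gpos) (v : V.carrier) : actPos V y (1 ⊗ₜ v) = 0 :=
  (exists_actPos V).choose_spec.1 y v

theorem actPos_wedge (y : L.gpos) (x : L.gneg) (m : KacSpace V) :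
    actPos V y (wedge x m) = actZero V (bracketPosNeg L y x) m - wedge x (actPos V y m) :=
  (exists_actPos V).choose_spec.2 y x m

theorem exists_kacParity : ∃ P : KacSpace V →ₗ[ℂ] KacSpace V,
    (∀ v, P (1 ⊗ₜ v) = 1 ⊗ₜ parityMap V.grading v) ∧
    ∀ x m, P (wedge x m) = -wedge x (P m) := by
  obtain ⟨P, P1, PX⟩ := exists_wedge_rec_neg
    (0 : L.gneg →ₗ[ℂ] KacSpace V →ₗ[ℂ] KacSpace V)
    (TensorProduct.mk ℂ _ _ 1 ∘ₗ parityMap V.grading) (fun x m => by simp)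
  exact ⟨P, P1, fun x m => by simpa using PX x m⟩

/-- The parity involution of `Λ(𝔤₋₁) ⊗ V`. -/
def kacParity : KacSpace V →ₗ[ℂ] KacSpace V := (exists_kacParity V).choose

theorem kacParity_one (v : V.carrier) :
    kacParity V (1 ⊗ₜ v) = 1 ⊗ₜ parityMap V.grading v := (exists_kacParity V).choose_spec.1 v

theorem kacParity_wedge (x : L.gneg) (m : KacSpace V) :
    kacParity V (wedge x m) = -wedge x (kacParity V m) :=
  (exists_kacParity V).choose_spec.2 x m

theorem kacParity_kacParity (m : KacSpace V) : kacParity V (kacParity V m) = m := by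
  induction m using wedge_induction with
  | one v => simp [kacParity_one, parityMap_parityMap]
  | add m m' hm hm' => simp only [map_add, hm, hm']
  | wedge x m hm => simp [kacParity_wedge, hm]

theorem kacParity_actZero (h : L.g0) (m : KacSpace V) :
    kacParity V (actZero V h m) = actZero V h (kacParity V m) := by
  induction m using wedge_induction with
  | one v =>
    rw [actZero_one, kacParity_one, kacParity_one, actZero_one,
      map_parityMap V.grading V.grading (V.act h) (V.act_ev h) (V.act_od h)]
  | add m m' hm hm' => simp only [map_add, hm, hm']
  | wedge x m hm => simp only [kacParity_wedge, actZero_wedge, map_add, map_neg, hm]; abel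

theorem kacParity_actPos (y : L.gpos) (m : KacSpace V) :
    kacParity V (actPos V y m) = -actPos V y (kacParity V m) := by
  induction m using wedge_induction with
  | one v => simp [actPos_one, kacParity_one]
  | add m m' hm hm' => simp only [map_add, hm, hm']; abel
  | wedge x m hm =>
    simp only [kacParity_wedge, actPos_wedge, map_sub, map_neg, hm, kacParity_actZero]
    abel

theorem actZero_bracket (h h' : L.g0) (m : KacSpace V) :
    actZero V ⟨L.bracket ↑h ↑h', L.br_00 ↑h h.2 ↑h' h'.2⟩ m =
      actZero V h (actZero V h' m) - actZero V h' (actZero V h m) := by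
  induction m using wedge_induction with
  | one v => simp [actZero_one, V.act_br, TensorProduct.tmul_sub]
  | add m m' hm hm' => simp only [map_add, hm, hm']; abel
  | wedge x m hm =>
    have e : adNeg L ⟨L.bracket ↑h ↑h', L.br_00 ↑h h.2 ↑h' h'.2⟩ x =
        adNeg L h (adNeg L h' x) - adNeg L h' (adNeg L h x) :=
      Subtype.ext (eq_sub_of_add_eq (L.jacobi_e h h' x (Or.inl h.2)).symm)
    simp only [actZero_wedge, map_add, hm, e, map_sub, LinearMap.sub_apply]
    abel

theorem actPos_bracket (h : L.g0) (y : L.gpos) (m : KacSpace V) :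
    actPos V (adPos L h y) m = actZero V h (actPos V y m) - actPos V y (actZero V h m) := by
  induction m using wedge_induction with
  | one v => simp [actZero_one, actPos_one]
  | add m m' hm hm' => simp only [map_add, hm, hm']; abel
  | wedge x m hm =>
    have e : bracketPosNeg L (adPos L h y) x =
        ⟨L.bracket ↑h ↑(bracketPosNeg L y x), L.br_00 ↑h h.2 _ (bracketPosNeg L y x).2⟩ -
          bracketPosNeg L y (adNeg L h x) :=
      Subtype.ext (eq_sub_of_add_eq (L.jacobi_e h y x (Or.inl h.2)).symm)
    simp only [actZero_wedge, actPos_wedge, map_add, hm, e, map_sub, LinearMap.sub_apply,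
      actZero_bracket]
    abel

theorem actPos_anticomm (y y' : L.gpos) (m : KacSpace V) :
    actPos V y (actPos V y' m) + actPos V y' (actPos V y m) = 0 := by
  induction m using wedge_induction with
  | one v => simp [actPos_one]
  | add m m' hm hm' =>
    simp only [map_add]
    rw [add_add_add_comm, hm, hm', add_zero]
  | wedge x m hm =>
    have e : adPos L (bracketPosNeg L y x) y' = -adPos L (bracketPosNeg L y' x) y := by
      have hy : (y : L.carrier) ∈ L.gneg ⊔ L.gpos := Submodule.mem_sup_right y.2
      have hy' : (y' : L.carrier) ∈ L.gneg ⊔ L.gpos := Submodule.mem_sup_right y'.2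
      have hj := L.jacobi_oo y hy y' hy' x
      rw [L.br_pp y y.2 y' y'.2, map_zero, LinearMap.zero_apply, zero_sub] at hj
      refine Subtype.ext ?_
      change L.bracket (L.bracket y x) y' = -L.bracket (L.bracket y' x) y
      rw [L.skew_e _ (L.br_pn y y.2 x x.2), L.skew_e _ (L.br_pn y' y'.2 x x.2), hj, neg_neg]
    have h1 := actPos_bracket V (bracketPosNeg L y x) y' m
    have h2 := actPos_bracket V (bracketPosNeg L y' x) y m
    rw [e, map_neg, LinearMap.neg_apply, h2] at h1
    have h3 := congrArg (wedge x) (eq_neg_of_add_eq_zero_left hm)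
    rw [map_neg] at h3
    simp only [actPos_wedge, map_sub, h3]
    rw [← sub_eq_zero] at h1
    rw [← h1]
    abel

/-- The triangular decomposition `𝔤 = 𝔤₀ ⊕ 𝔤₋₁ ⊕ 𝔤₁`. -/
def triangularMap (L : GLSA) : (L.g0 × L.gneg × L.gpos) →ₗ[ℂ] L.carrier :=
  L.g0.subtype.coprod (L.gneg.subtype.coprod L.gpos.subtype)

theorem triangularMap_bijective (L : GLSA) : Bijective (triangularMap L) := by
  constructor
  · rw [← LinearMap.ker_eq_bot, LinearMap.ker_eq_bot']
    rintro ⟨h, x, y⟩ he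
    have he' : (h : L.carrier) + (x + y) = 0 := he
    have hxy : (x : L.carrier) + y ∈ L.gneg ⊔ L.gpos :=
      Submodule.add_mem_sup x.2 y.2
    have h0 : (h : L.carrier) = 0 :=
      Submodule.disjoint_def.1 L.oddCompl.disjoint _ h.2
        (eq_neg_of_add_eq_zero_left he' ▸ Submodule.neg_mem _ hxy)
    rw [h0, zero_add] at he'
    have x0 : (x : L.carrier) = 0 :=
      Submodule.disjoint_def.1 L.disjNP _ x.2
        (eq_neg_of_add_eq_zero_left he' ▸ Submodule.neg_mem _ y.2)
    rw [x0, zero_add] at he'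
    simp_all
  · intro z
    have hz : z ∈ L.g0 ⊔ (L.gneg ⊔ L.gpos) := L.oddCompl.sup_eq_top ▸ Submodule.mem_top
    obtain ⟨h, hh, w, hw, rfl⟩ := Submodule.mem_sup.1 hz
    obtain ⟨x, hx, y, hy, rfl⟩ := Submodule.mem_sup.1 hw
    exact ⟨(⟨h, hh⟩, ⟨x, hx⟩, ⟨y, hy⟩), rfl⟩

theorem exists_triangular (z : L.carrier) :
    ∃ (h : L.g0) (x : L.gneg) (y : L.gpos), z = h + x + y := by
  obtain ⟨⟨h, x, y⟩, rfl⟩ := (triangularMap_bijective L).2 z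
  exact ⟨h, x, y, by simp [triangularMap, add_assoc]⟩

/-- The action of `𝔤` on `Λ(𝔤₋₁) ⊗ V`. -/
def kacAct : L.carrier →ₗ[ℂ] KacSpace V →ₗ[ℂ] KacSpace V :=
  (actZero V).coprod (wedge.coprod (actPos V)) ∘ₗ
    (LinearEquiv.ofBijective _ (triangularMap_bijective L)).symm

theorem kacAct_add (h : L.g0) (x : L.gneg) (y : L.gpos) :
    kacAct V (h + (x + y)) = actZero V h + (wedge x + actPos V y) := by
  have e : (LinearEquiv.ofBijective _ (triangularMap_bijective L)).symm
      ((h : L.carrier) + (x + y)) = (h, x, y) := by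
    rw [LinearEquiv.symm_apply_eq]; rfl
  simp [kacAct, e]

theorem kacAct_zero (h : L.g0) : kacAct V h = actZero V h := by
  simpa using kacAct_add V h 0 0

theorem kacAct_neg (x : L.gneg) : kacAct V x = wedge x := by
  simpa using kacAct_add V 0 x 0

theorem kacAct_pos (y : L.gpos) : kacAct V y = actPos V y := by
  simpa using kacAct_add V 0 0 y

theorem kacAct_zero' {h : L.carrier} (hh : h ∈ L.g0) : kacAct V h = actZero V ⟨h, hh⟩ :=
  kacAct_zero V ⟨h, hh⟩

theorem kacAct_neg' {x : L.carrier} (hx : x ∈ L.gneg) : kacAct V x = wedge ⟨x, hx⟩ :=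
  kacAct_neg V ⟨x, hx⟩

theorem kacAct_pos' {y : L.carrier} (hy : y ∈ L.gpos) : kacAct V y = actPos V ⟨y, hy⟩ :=
  kacAct_pos V ⟨y, hy⟩

theorem kacAct_bracket_zero (h : L.g0) (z : L.carrier) (m : KacSpace V) :
    kacAct V (L.bracket h z) m = kacAct V h (kacAct V z m) - kacAct V z (kacAct V h m) := by
  obtain ⟨h', x, y, rfl⟩ := exists_triangular z
  simp only [map_add, LinearMap.add_apply, kacAct_zero, kacAct_neg, kacAct_pos,
    kacAct_zero' V (L.br_00 h h.2 h' h'.2), kacAct_neg' V (L.br_0n h h.2 x x.2),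
    kacAct_pos' V (L.br_0p h h.2 y y.2)]
  have e1 := actZero_bracket V h h' m
  have e2 : wedge ⟨L.bracket h x, L.br_0n h h.2 x x.2⟩ m =
      actZero V h (wedge x m) - wedge x (actZero V h m) :=
    eq_sub_of_add_eq (actZero_wedge V h x m).symm
  have e3 : actPos V ⟨L.bracket h y, L.br_0p h h.2 y y.2⟩ m = _ := actPos_bracket V h y m
  rw [e1, e2, e3]
  abel

theorem kacAct_bracket_pos_neg (y : L.gpos) (x : L.gneg) (m : KacSpace V) :
    kacAct V (L.bracket y x) m = actPos V y (wedge x m) + wedge x (actPos V y m) := by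
  rw [kacAct_zero' V (L.br_pn y y.2 x x.2), actPos_wedge, sub_add_cancel]
  rfl

theorem kacAct_bracket_odd {z w : L.carrier} (hz : z ∈ L.odd) (hw : w ∈ L.odd) (m : KacSpace V) :
    kacAct V (L.bracket z w) m = kacAct V z (kacAct V w m) + kacAct V w (kacAct V z m) := by
  obtain ⟨x, hx, y, hy, rfl⟩ := Submodule.mem_sup.1 hz
  obtain ⟨x', hx', y', hy', rfl⟩ := Submodule.mem_sup.1 hw
  lift x to L.gneg using hx
  lift y to L.gpos using hy
  lift x' to L.gneg using hx'
  lift y' to L.gpos using hy'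
  have e1 : L.bracket (x : L.carrier) y' = L.bracket y' x :=
    L.skew_oo _ (Submodule.mem_sup_left x.2) _ (Submodule.mem_sup_right y'.2)
  have e2 := actPos_anticomm V y y' m
  have e3 := wedge_anticomm x x' m
  simp only [map_add, LinearMap.add_apply, L.br_nn x x.2 x' x'.2, L.br_pp y y.2 y' y'.2, e1,
    kacAct_bracket_pos_neg, map_zero, LinearMap.zero_apply, kacAct_neg, kacAct_pos]
  rw [e3, eq_neg_of_add_eq_zero_left e2]
  abel

theorem kacParity_kacAct_odd {z : L.carrier} (hz : z ∈ L.odd) (m : KacSpace V) :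
    kacParity V (kacAct V z m) = -kacAct V z (kacParity V m) := by
  obtain ⟨x, hx, y, hy, rfl⟩ := Submodule.mem_sup.1 hz
  simp only [map_add, LinearMap.add_apply, kacAct_neg' V hx, kacAct_pos' V hy, kacParity_wedge,
    kacParity_actPos, neg_add]

/-- The explicit model of the Kac module of `V` on the space `Λ(𝔤₋₁) ⊗ V`. -/
def kacModel : SMod L where
  carrier := KacSpace V
  act := kacAct V
  ev := LinearMap.ker (kacParity V - LinearMap.id)
  od := LinearMap.ker (kacParity V + LinearMap.id)
  grading := isCompl_ker_of_involution _ (kacParity_kacParity V)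
  act_e_ev x hx m hm := by
    rw [LinearMap.mem_ker, LinearMap.sub_apply, sub_eq_zero, LinearMap.id_apply] at hm ⊢
    rw [kacAct_zero' V hx, kacParity_actZero, hm]
  act_e_od x hx m hm := by
    rw [LinearMap.mem_ker, LinearMap.add_apply, add_eq_zero_iff_eq_neg, LinearMap.id_apply] at hm ⊢
    rw [kacAct_zero' V hx, kacParity_actZero, hm, map_neg]
  act_o_ev x hx m hm := by
    rw [LinearMap.mem_ker, LinearMap.sub_apply, sub_eq_zero, LinearMap.id_apply] at hm
    rw [LinearMap.mem_ker, LinearMap.add_apply, add_eq_zero_iff_eq_neg, LinearMap.id_apply,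
      kacParity_kacAct_odd V hx, hm]
  act_o_od x hx m hm := by
    rw [LinearMap.mem_ker, LinearMap.add_apply, add_eq_zero_iff_eq_neg, LinearMap.id_apply] at hm
    rw [LinearMap.mem_ker, LinearMap.sub_apply, sub_eq_zero, LinearMap.id_apply,
      kacParity_kacAct_odd V hx, hm, map_neg, neg_neg]
  act_br_e x y hxy m := by
    rcases hxy with hx | hy
    · exact kacAct_bracket_zero V ⟨x, hx⟩ y m
    · rw [← neg_neg (L.bracket x y), ← L.skew_e y hy, map_neg, LinearMap.neg_apply,
        kacAct_bracket_zero V ⟨y, hy⟩ x m, neg_sub]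
  act_br_oo x hx y hy m := kacAct_bracket_odd V hx hy m

end Model

section WedgeList

open scoped TensorProduct

variable {G V : Type*} [AddCommGroup G] [Module ℂ G] [AddCommGroup V] [Module ℂ V]

/-- Iterated exterior multiplication on `Λ(G) ⊗ V`. -/
def wedgeList : List G → Module.End ℂ (ExteriorAlgebra ℂ G ⊗[ℂ] V)
  | [] => LinearMap.id
  | x :: l => wedge x ∘ₗ wedgeList l

theorem wedgeList_tmul (l : List G) (a : ExteriorAlgebra ℂ G) (v : V) :
    wedgeList l (a ⊗ₜ[ℂ] v) = ((l.map (ExteriorAlgebra.ι ℂ)).prod * a) ⊗ₜ v := by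
  induction l with
  | nil => simp [wedgeList]
  | cons x l ih => simp [wedgeList, ih, wedge_tmul, mul_assoc]

theorem wedgeList_ofFn_tmul {n : ℕ} (f : Fin n → G) (a : ExteriorAlgebra ℂ G) (v : V) :
    wedgeList (List.ofFn f) (a ⊗ₜ[ℂ] v) = (ExteriorAlgebra.ιMulti ℂ n f * a) ⊗ₜ v := by
  rw [wedgeList_tmul, List.map_ofFn, ExteriorAlgebra.ιMulti_apply]
  rfl

theorem wedgeList_eq_zero_of_finrank_lt [FiniteDimensional ℂ G] {l : List G}
    (hl : finrank ℂ G < l.length) (m : ExteriorAlgebra ℂ G ⊗[ℂ] V) : wedgeList l m = 0 := by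
  have hd : ExteriorAlgebra.ιMulti ℂ l.length l.get = 0 := by
    refine AlternatingMap.map_linearDependent _ _ fun hli => ?_
    have := hli.fintype_card_le_finrank
    simp only [Fintype.card_fin] at this
    omega
  induction m with
  | zero => simp
  | add a b ha hb => simp [ha, hb]
  | tmul a v =>
    rw [← List.ofFn_get l, wedgeList_ofFn_tmul, hd, zero_mul, TensorProduct.zero_tmul]

variable {n : ℕ} (b : Basis (Fin n) ℂ G)

theorem exists_wedgeList_eq_smul {l : List G} (hl : l.length = n) :
    ∃ c : ℂ, ∀ m : ExteriorAlgebra ℂ G ⊗[ℂ] V, wedgeList l m = c • wedgeList (List.ofFn b) m := by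
  subst hl
  have hg : ExteriorAlgebra.ιMulti ℂ l.length = (LinearMap.toSpanSingleton ℂ _
      (ExteriorAlgebra.ιMulti ℂ l.length b)).compAlternatingMap b.det := by
    refine Basis.ext_alternating b fun i hi => ?_
    let σ : Equiv.Perm (Fin l.length) :=
      Equiv.ofBijective i (Finite.injective_iff_bijective.1 hi)
    change ExteriorAlgebra.ιMulti ℂ l.length (b ∘ σ) = _
    have hσ : b.det (fun j => b (i j)) = (Equiv.Perm.sign σ : ℤ) := by
      have := b.det.map_perm b σ
      rw [Basis.det_self] at this
      simp only [Units.smul_def, zsmul_eq_mul, mul_one] at this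
      exact this
    rw [AlternatingMap.map_perm, LinearMap.compAlternatingMap_apply, hσ,
      LinearMap.toSpanSingleton_apply, Units.smul_def, Int.cast_smul_eq_zsmul]
  refine ⟨b.det l.get, fun m => ?_⟩
  induction m with
  | zero => simp
  | add p q hp hq => simp [hp, hq]
  | tmul a v =>
    conv_lhs => rw [← List.ofFn_get l]
    rw [wedgeList_ofFn_tmul, wedgeList_ofFn_tmul, TensorProduct.smul_tmul', ← smul_mul_assoc]
    conv_lhs => rw [hg]
    rfl

theorem exists_contraction (d : G →ₗ[ℂ] ℂ) :
    ∃ D : ExteriorAlgebra ℂ G ⊗[ℂ] V →ₗ[ℂ] ExteriorAlgebra ℂ G ⊗[ℂ] V,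
      (∀ v, D (1 ⊗ₜ v) = 0) ∧ ∀ x m, D (wedge x m) = d x • m - wedge x (D m) := by
  obtain ⟨D, h1, h2⟩ := exists_wedge_rec_neg (V := V) (d.smulRight LinearMap.id) 0
    (fun x m => by simp)
  exact ⟨D, h1, fun x m => by simpa using h2 x m⟩

theorem contraction_wedgeList {d : G →ₗ[ℂ] ℂ}
    {D : ExteriorAlgebra ℂ G ⊗[ℂ] V →ₗ[ℂ] ExteriorAlgebra ℂ G ⊗[ℂ] V}
    (hD : ∀ x m, D (wedge x m) = d x • m - wedge x (D m)) {l : List G} (hl : ∀ x ∈ l, d x = 0)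
    (m : ExteriorAlgebra ℂ G ⊗[ℂ] V) :
    D (wedgeList l m) = wedgeList l ((-1 : ℂ) ^ l.length • D m) := by
  induction l with
  | nil => simp [wedgeList]
  | cons x l ih =>
    simp only [List.mem_cons, forall_eq_or_imp] at hl
    simp only [wedgeList, LinearMap.comp_apply, hD, hl.1, ih hl.2, map_smul, List.length_cons]
    module

theorem exists_eq_wedgeList_of_wedge_eq_zero {m : ExteriorAlgebra ℂ G ⊗[ℂ] V}
    (hm : ∀ x, wedge x m = 0) {l : List (Fin n)} (hl : l.Nodup) :
    ∃ m', m = wedgeList (l.map b) m' := by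
  induction l with
  | nil => exact ⟨m, rfl⟩
  | cons i l ih =>
    rw [List.nodup_cons] at hl
    obtain ⟨m', hm'⟩ := ih hl.2
    obtain ⟨D, -, hD⟩ := exists_contraction (V := V) (b.coord i)
    have h := hD (b i) m
    rw [hm, map_zero, Basis.coord_apply, Basis.repr_self, Finsupp.single_eq_same, one_smul] at h
    refine ⟨(-1 : ℂ) ^ (l.map b).length • D m', ?_⟩
    simp only [List.map_cons, wedgeList, LinearMap.comp_apply]
    rw [← contraction_wedgeList hD, ← hm']
    · exact sub_eq_zero.1 h.symm
    · intro x hx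
      obtain ⟨j, hj, rfl⟩ := List.mem_map.1 hx
      have hij : j ≠ i := fun e => hl.1 (e ▸ hj)
      simp [hij]

theorem wedgeList_wedge (l : List G) (x : G) (m : ExteriorAlgebra ℂ G ⊗[ℂ] V) :
    wedgeList l (wedge x m) = wedgeList (l ++ [x]) m := by
  induction l with
  | nil => rfl
  | cons y l ih => simp [wedgeList, ih]

theorem exists_wedgeList_one_eq [FiniteDimensional ℂ G] {l : List G} (hl : l.length = finrank ℂ G)
    (m : ExteriorAlgebra ℂ G ⊗[ℂ] V) : ∃ v, wedgeList l m = wedgeList l (1 ⊗ₜ v) := by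
  induction m using wedge_induction with
  | one v => exact ⟨v, rfl⟩
  | add m m' hm hm' =>
    obtain ⟨v, hv⟩ := hm
    obtain ⟨v', hv'⟩ := hm'
    exact ⟨v + v', by rw [map_add, hv, hv', TensorProduct.tmul_add, map_add]⟩
  | wedge x m _ =>
    refine ⟨0, ?_⟩
    rw [wedgeList_wedge, wedgeList_eq_zero_of_finrank_lt (by simp [hl]), TensorProduct.tmul_zero,
      map_zero]

theorem one_tmul_eq_zero {v : V} (hv : (1 : ExteriorAlgebra ℂ G) ⊗ₜ[ℂ] v = 0) : v = 0 := by
  have h := congrArg (TensorProduct.lid ℂ V ∘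
    LinearMap.rTensor V (ExteriorAlgebra.algebraMapInv (R := ℂ) (M := G)).toLinearMap) hv
  simpa using h

theorem eq_zero_of_wedgeList_one_eq_zero {l : List (Fin n)} (hl : l.Nodup) {v : V}
    (hv : wedgeList (l.map b) (1 ⊗ₜ v) = 0) : v = 0 := by
  induction l with
  | nil => exact one_tmul_eq_zero hv
  | cons i l ih =>
    rw [List.nodup_cons] at hl
    obtain ⟨D, hD1, hD⟩ := exists_contraction (V := V) (b.coord i)
    refine ih hl.2 ?_
    have h := hD (b i) (wedgeList (l.map b) (1 ⊗ₜ v))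
    rw [contraction_wedgeList hD, hD1, smul_zero, map_zero, map_zero, sub_zero, Basis.coord_apply,
      Basis.repr_self, Finsupp.single_eq_same, one_smul] at h
    · rw [← h]
      exact (congrArg D hv).trans (map_zero D)
    · intro x hx
      obtain ⟨j, hj, rfl⟩ := List.mem_map.1 hx
      have hij : j ≠ i := fun e => hl.1 (e ▸ hj)
      simp [hij]

theorem exists_eq_wedgeList_top [FiniteDimensional ℂ G] (b : Basis (Fin (finrank ℂ G)) ℂ G)
    {m : ExteriorAlgebra ℂ G ⊗[ℂ] V} (hm : ∀ x, wedge x m = 0) :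
    ∃ v, m = wedgeList (List.ofFn b) (1 ⊗ₜ v) := by
  obtain ⟨m', rfl⟩ := exists_eq_wedgeList_of_wedge_eq_zero b hm (List.nodup_finRange _)
  obtain ⟨v, hv⟩ := exists_wedgeList_one_eq (l := List.ofFn b) (by simp) m'
  exact ⟨v, by rw [← hv, List.ofFn_eq_map]⟩

theorem exists_ne_zero_wedge_eq_zero [FiniteDimensional ℂ G]
    {N : Submodule ℂ (ExteriorAlgebra ℂ G ⊗[ℂ] V)} (hN : ∀ x, ∀ m ∈ N, wedge x m ∈ N)
    (hN0 : N ≠ ⊥) : ∃ m ∈ N, m ≠ 0 ∧ ∀ x, wedge x m = 0 := by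
  have key : ∀ l : List G, ∃ m ∈ N, m ≠ 0 ∧ ∀ x ∈ l, wedge x m = 0 := by
    intro l
    induction l with
    | nil =>
      obtain ⟨m, hm, hm0⟩ := N.ne_bot_iff.1 hN0
      exact ⟨m, hm, hm0, by simp⟩
    | cons x l ih =>
      obtain ⟨m, hm, hm0, hl⟩ := ih
      by_cases hx : wedge x m = 0
      · exact ⟨m, hm, hm0, by simpa [hx] using hl⟩
      · refine ⟨wedge x m, hN x m hm, hx, ?_⟩
        simp only [List.mem_cons, forall_eq_or_imp, wedge_self, true_and]
        intro y hy
        rw [wedge_anticomm, hl y hy, map_zero, neg_zero]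
  obtain ⟨m, hm, hm0, hl⟩ := key (List.ofFn (finBasis ℂ G))
  refine ⟨m, hm, hm0, fun x => ?_⟩
  have h0 : wedge.flip m = 0 :=
    (finBasis ℂ G).ext fun i => hl _ (List.mem_ofFn.2 ⟨i, rfl⟩)
  exact LinearMap.congr_fun h0 x

end WedgeList

section KacModule

open scoped TensorProduct

variable {L : GLSA} {V : SMod0 L}

theorem SMod.isSubmod_iff (K : SMod L) (N : Submodule ℂ K.carrier) :
    K.IsSubmod N ↔ (∀ x, ∀ m ∈ N, K.act x m ∈ N) ∧ ∀ m ∈ N, parityMap K.grading m ∈ N :=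
  and_congr_right fun _ => le_inf_sup_inf_iff K.grading N

theorem SMod0.isSubmod_iff (V : SMod0 L) (N : Submodule ℂ V.carrier) :
    V.IsSubmod N ↔ (∀ x, ∀ m ∈ N, V.act x m ∈ N) ∧ ∀ m ∈ N, parityMap V.grading m ∈ N :=
  and_congr_right fun _ => le_inf_sup_inf_iff V.grading N

theorem SMod.act_neg_act_neg (K : SMod L) {x : L.carrier} (hx : x ∈ L.gneg) (m : K.carrier) :
    K.act x (K.act x m) = 0 := by
  have hx' : x ∈ L.odd := Submodule.mem_sup_left hx
  have h := K.act_br_oo x hx' x hx' m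
  rw [L.br_nn x hx x hx, map_zero, LinearMap.zero_apply] at h
  exact eq_zero_of_eq_neg (eq_neg_of_add_eq_zero_left h.symm)

theorem actZero_wedgeList (h : L.g0) (l : List L.gneg) (m : KacSpace V) :
    actZero V h (wedgeList l m) - wedgeList l (actZero V h m) ∈
      Submodule.span ℂ {w | ∃ l' : List L.gneg, l'.length = l.length ∧ w = wedgeList l' m} := by
  induction l with
  | nil => simp [wedgeList]
  | cons x l ih =>
    have e : actZero V h (wedgeList (x :: l) m) - wedgeList (x :: l) (actZero V h m) =
        wedge (adNeg L h x) (wedgeList l m) +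
          wedge x (actZero V h (wedgeList l m) - wedgeList l (actZero V h m)) := by
      simp only [wedgeList, LinearMap.comp_apply, actZero_wedge, map_sub]
      abel
    rw [e]
    refine Submodule.add_mem _ (Submodule.subset_span ⟨adNeg L h x :: l, rfl, rfl⟩) ?_
    have hle : Submodule.span ℂ {w | ∃ l' : List L.gneg, l'.length = l.length ∧
        w = wedgeList l' m} ≤ (Submodule.span ℂ {w | ∃ l' : List L.gneg,
          l'.length = (x :: l).length ∧ w = wedgeList l' m}).comap (wedge x) := by
      rw [Submodule.span_le]
      rintro _ ⟨l', hl', rfl⟩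
      exact Submodule.subset_span ⟨x :: l', by simp [hl'], rfl⟩
    exact hle ih

theorem kacParity_wedgeList (l : List L.gneg) (m : KacSpace V) :
    kacParity V (wedgeList l m) = (-1 : ℂ) ^ l.length • wedgeList l (kacParity V m) := by
  induction l with
  | nil => simp [wedgeList]
  | cons x l ih =>
    simp only [wedgeList, LinearMap.comp_apply, kacParity_wedge, ih, map_smul, List.length_cons]
    module

theorem wedgeList_one_mem [FiniteDimensional ℂ L.gneg] (hV : V.IsSimple)
    {N : Submodule ℂ (KacSpace V)} (hN : ∀ x, ∀ m ∈ N, kacAct V x m ∈ N)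
    (hP : ∀ m ∈ N, kacParity V m ∈ N) (hN0 : N ≠ ⊥) {l : List L.gneg}
    (hl : l.length = finrank ℂ L.gneg) (v : V.carrier) : wedgeList l (1 ⊗ₜ v) ∈ N := by
  let b := finBasis ℂ L.gneg
  let W : Submodule ℂ V.carrier :=
    N.comap (wedgeList (List.ofFn b) ∘ₗ TensorProduct.mk ℂ (ExteriorAlgebra ℂ L.gneg) V.carrier 1)
  have hWmem : ∀ w, w ∈ W ↔ wedgeList (List.ofFn b) (1 ⊗ₜ w) ∈ N := fun _ => Iff.rfl
  have hW : V.IsSubmod W := by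
    rw [SMod0.isSubmod_iff]
    refine ⟨fun h w hw => ?_, fun w hw => ?_⟩
    · rw [hWmem] at hw ⊢
      have h1 := hN h _ hw
      rw [kacAct_zero] at h1
      have h2 := actZero_wedgeList h (List.ofFn b) (1 ⊗ₜ w : KacSpace V)
      have hle : Submodule.span ℂ {u | ∃ l' : List L.gneg,
          l'.length = (List.ofFn b).length ∧ u = wedgeList l' (1 ⊗ₜ w : KacSpace V)} ≤ N := by
        rw [Submodule.span_le]
        rintro _ ⟨l', hl', rfl⟩
        obtain ⟨c, hc⟩ := exists_wedgeList_eq_smul (V := V.carrier) b (l := l') (by simpa using hl')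
        rw [hc]
        exact N.smul_mem c hw
      have h3 := N.sub_mem h1 (hle h2)
      rwa [sub_sub_cancel, actZero_one] at h3
    · rw [hWmem] at hw ⊢
      have h1 := N.smul_mem ((-1 : ℂ) ^ (List.ofFn b).length) (hP _ hw)
      rwa [kacParity_wedgeList, smul_smul, ← mul_pow, neg_one_mul, neg_neg, one_pow, one_smul,
        kacParity_one] at h1
  obtain ⟨m, hm, hm0, hx⟩ := exists_ne_zero_wedge_eq_zero
    (fun x m hm => by simpa only [kacAct_neg] using hN x m hm) hN0
  obtain ⟨w, rfl⟩ := exists_eq_wedgeList_top b hx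
  have hWtop : W = ⊤ := by
    refine (hV.2 W hW).resolve_left fun hbot => hm0 ?_
    have hw0 : w = 0 := (Submodule.eq_bot_iff W).1 hbot w hm
    rw [hw0, TensorProduct.tmul_zero, map_zero]
  obtain ⟨c, hc⟩ := exists_wedgeList_eq_smul (V := V.carrier) b hl
  rw [hc]
  exact N.smul_mem c ((hWmem v).1 (hWtop ▸ Submodule.mem_top))

variable {K : SMod L} {η : V.carrier →ₗ[ℂ] K.carrier}

theorem IsKac.exists_equiv (hK : IsKac V K η) : ∃ e : KacSpace V ≃ₗ[ℂ] K.carrier,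
    (∀ v, e (1 ⊗ₜ v) = η v) ∧ (∀ x m, e (kacAct V x m) = K.act x (e m)) ∧
    ∀ m, e (kacParity V m) = parityMap K.grading (e m) := by
  obtain ⟨Ψ, h1, hX⟩ := exists_wedge_rec (K.act ∘ₗ L.gneg.subtype)
    (0 : L.gneg →ₗ[ℂ] KacSpace V →ₗ[ℂ] K.carrier) η (fun x m => K.act_neg_act_neg x.2 m)
    (fun x m => by simp)
  replace hX : ∀ (x : L.gneg) m, Ψ (wedge x m) = K.act x (Ψ m) := fun x m => by simpa using hX x m
  have hH : ∀ h m, Ψ (actZero V h m) = K.act h (Ψ m) := by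
    intro h m
    induction m using wedge_induction with
    | one v => rw [actZero_one, h1, h1, hK.equivar]
    | add m m' hm hm' => simp only [map_add, hm, hm']
    | wedge x m hm =>
      have := K.act_br_e h x (Or.inl h.2) (Ψ m)
      rw [actZero_wedge, map_add, hX, hX, hX, hm]
      exact add_eq_of_eq_sub this
  have hY : ∀ y m, Ψ (actPos V y m) = K.act y (Ψ m) := by
    intro y m
    induction m using wedge_induction with
    | one v => rw [actPos_one, h1, map_zero, hK.pos_zero y y.2]
    | add m m' hm hm' => simp only [map_add, hm, hm']
    | wedge x m hm =>
      have := K.act_br_oo y (Submodule.mem_sup_right y.2) x (Submodule.mem_sup_left x.2) (Ψ m)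
      rw [actPos_wedge, map_sub, hX, hX, hH, hm]
      exact sub_eq_of_eq_add this
  have hP : ∀ m, Ψ (kacParity V m) = parityMap K.grading (Ψ m) := by
    intro m
    induction m using wedge_induction with
    | one v =>
      rw [kacParity_one, h1, h1, map_parityMap V.grading K.grading η hK.map_ev hK.map_od]
    | add m m' hm hm' => simp only [map_add, hm, hm']
    | wedge x m hm =>
      have hx : (x : L.carrier) ∈ L.odd := Submodule.mem_sup_left x.2
      rw [kacParity_wedge, map_neg, hX, hX, hm,
        map_parityMap_neg K.grading K.grading _ (K.act_o_ev x hx) (K.act_o_od x hx), neg_neg]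
  have hact : ∀ x m, Ψ (kacAct V x m) = K.act x (Ψ m) := by
    intro z m
    obtain ⟨h, x, y, rfl⟩ := exists_triangular z
    simp only [map_add, LinearMap.add_apply, kacAct_zero, kacAct_neg, kacAct_pos, hX, hH, hY]
  have hsurj : Surjective Ψ := by
    rw [← LinearMap.range_eq_top, eq_top_iff, ← hK.generates]
    refine sInf_le ⟨(K.isSubmod_iff _).2 ⟨?_, ?_⟩, ?_⟩
    · rintro x _ ⟨m, rfl⟩
      exact ⟨_, hact x m⟩
    · rintro _ ⟨m, rfl⟩
      exact ⟨_, hP m⟩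
    · rintro _ ⟨v, rfl⟩
      exact ⟨_, h1 v⟩
  obtain ⟨Φ, hΦ, -⟩ := hK.universal (kacModel V) (TensorProduct.mk ℂ _ _ 1)
    (fun v hv => by
      change 1 ⊗ₜ v ∈ LinearMap.ker (kacParity V - LinearMap.id)
      simp [kacParity_one, parityMap_of_mem_ev V.grading hv])
    (fun v hv => by
      change 1 ⊗ₜ v ∈ LinearMap.ker (kacParity V + LinearMap.id)
      simp [kacParity_one, parityMap_of_mem_od V.grading hv, TensorProduct.tmul_neg])
    (fun h v => by
      change 1 ⊗ₜ V.act h v = kacAct V h (1 ⊗ₜ v)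
      rw [kacAct_zero, actZero_one])
    (fun y hy v => by
      change kacAct V y (1 ⊗ₜ v) = 0
      rw [kacAct_pos' V hy, actPos_one])
  have hinv : ∀ m, Φ.toLin (Ψ m) = m := by
    intro m
    induction m using wedge_induction with
    | one v => rw [h1, hΦ]; rfl
    | add m m' hm hm' =>
      rw [map_add, map_add, hm, hm']
      rfl
    | wedge x m hm =>
      rw [hX, Φ.equivar, hm]
      exact LinearMap.congr_fun (kacAct_neg V x) m
  exact ⟨LinearEquiv.ofBijective Ψ ⟨HasLeftInverse.injective ⟨_, hinv⟩, hsurj⟩, h1, hact, hP⟩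

theorem map_wedgeList_eq_actList {e : KacSpace V ≃ₗ[ℂ] K.carrier}
    (he : ∀ x m, e (kacAct V x m) = K.act x (e m)) (l : List L.gneg) (m : KacSpace V) :
    e (wedgeList l m) = K.actList (l.map Subtype.val) (e m) := by
  induction l with
  | nil => rfl
  | cons x l ih =>
    simp only [wedgeList, LinearMap.comp_apply, List.map_cons, SMod.actList, ← ih, ← he,
      kacAct_neg]

theorem IsKac.botPartNeg_le [FiniteDimensional ℂ L.gneg] (hV : V.IsSimple) (hK : IsKac V K η)
    {N : Submodule ℂ K.carrier} (hN : K.IsSubmod N) (hN0 : N ≠ ⊥) : botPartNeg V K η ≤ N := by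
  obtain ⟨e, he1, hact, hP⟩ := hK.exists_equiv
  rw [SMod.isSubmod_iff] at hN
  have hN0' : N.comap e.toLinearMap ≠ ⊥ := by
    obtain ⟨m, hm, hm0⟩ := N.ne_bot_iff.1 hN0
    exact Submodule.ne_bot_iff _ |>.2 ⟨e.symm m, by simpa using hm, by simpa using hm0⟩
  rw [botPartNeg, Submodule.span_le]
  rintro _ ⟨xs, v, hlen, hxs, rfl⟩
  lift xs to List L.gneg using hxs
  have h := wedgeList_one_mem hV (N := N.comap e.toLinearMap)
    (fun x m hm => by simpa [hact] using hN.1 x _ hm) (fun m hm => by simpa [hP] using hN.2 _ hm)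
    hN0' (l := xs) (by simpa using hlen) v
  have h' : e (wedgeList xs (1 ⊗ₜ v)) ∈ N := h
  rwa [map_wedgeList_eq_actList hact, he1] at h'

theorem SMod.gen_isSubmod (K : SMod L) (S : Submodule ℂ K.carrier) : K.IsSubmod (K.gen S) := by
  rw [SMod.isSubmod_iff]
  simp only [SMod.gen, Submodule.mem_sInf]
  exact ⟨fun x m hm N hN => hN.1.1 x m (hm N hN),
    fun m hm N hN => ((K.isSubmod_iff N).1 hN.1).2 m (hm N hN)⟩

theorem SMod.le_gen (K : SMod L) (S : Submodule ℂ K.carrier) : S ≤ K.gen S :=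
  le_sInf fun _ hN => hN.2

/-- A supermodule in which every nonzero sub-supermodule contains a fixed nonzero subspace has
simple socle and is indecomposable. -/
theorem SMod.socle_of_le (K : SMod L) {S : Submodule ℂ K.carrier} (hS : S ≠ ⊥)
    (h : ∀ N, K.IsSubmod N → N ≠ ⊥ → S ≤ N) :
    K.socle = K.gen S ∧ K.IsSimpleSub K.socle ∧ K.Indecomposable := by
  have hsimple : K.IsSimpleSub (K.gen S) := by
    refine ⟨K.gen_isSubmod S, fun h0 => hS (le_bot_iff.1 (h0 ▸ K.le_gen S)), fun N hN hle => ?_⟩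
    by_cases hN0 : N = ⊥
    · exact Or.inl hN0
    · exact Or.inr (le_antisymm hle (sInf_le ⟨hN, h N hN hN0⟩))
  have hsocle : K.socle = K.gen S := by
    refine le_antisymm (sSup_le fun N hN => ?_) (le_sSup hsimple)
    have hle : K.gen S ≤ N := sInf_le ⟨hN.1, h N hN.1 hN.2.1⟩
    exact ((hN.2.2 _ hsimple.1 hle).resolve_left hsimple.2.1).ge
  refine ⟨hsocle, hsocle ▸ hsimple, fun h0 => hS (le_bot_iff.1 (h0 ▸ le_top)), ?_⟩
  intro N₁ N₂ h1 h2 hinf _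
  by_contra! hne
  exact hS (le_bot_iff.1 (hinf ▸ le_inf (h N₁ h1 hne.1) (h N₂ h2 hne.2)))

theorem IsKac.botPartNeg_ne_bot [FiniteDimensional ℂ L.gneg] (hV : V.IsSimple)
    (hK : IsKac V K η) : botPartNeg V K η ≠ ⊥ := by
  obtain ⟨v, -, hv⟩ := (Submodule.ne_bot_iff _).1 hV.1
  obtain ⟨e, he1, hact, -⟩ := hK.exists_equiv
  let b := finBasis ℂ L.gneg
  refine (Submodule.ne_bot_iff _).2 ⟨e (wedgeList (List.ofFn b) (1 ⊗ₜ v)),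
    Submodule.subset_span ⟨(List.ofFn b).map Subtype.val, v, by simp, ?_, ?_⟩, fun h => hv ?_⟩
  · intro x hx
    obtain ⟨y, -, rfl⟩ := List.mem_map.1 hx
    exact y.2
  · rw [map_wedgeList_eq_actList hact, he1]
  · rw [LinearEquiv.map_eq_zero_iff, List.ofFn_eq_map] at h
    exact eq_zero_of_wedgeList_one_eq_zero b (List.nodup_finRange _) h

end KacModule

section Opposite

/-- The Lie superalgebra with the opposite `ℤ`-grading. -/
def GLSA.op (L : GLSA) : GLSA where
  carrier := L.carrier
  bracket := L.bracket
  gneg := L.gpos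
  g0 := L.g0
  gpos := L.gneg
  oddCompl := sup_comm L.gneg L.gpos ▸ L.oddCompl
  disjNP := L.disjNP.symm
  br_00 := L.br_00
  br_0p := L.br_0n
  br_0n := L.br_0p
  br_pn x hx y hy := by
    rw [L.skew_oo x (Submodule.mem_sup_left hx) y (Submodule.mem_sup_right hy)]
    exact L.br_pn y hy x hx
  br_pp := L.br_nn
  br_nn := L.br_pp
  skew_e := L.skew_e
  skew_oo x hx y hy :=
    L.skew_oo x (sup_comm L.gneg L.gpos ▸ hx) y (sup_comm L.gneg L.gpos ▸ hy)
  jacobi_e := L.jacobi_e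
  jacobi_oo x hx y hy :=
    L.jacobi_oo x (sup_comm L.gneg L.gpos ▸ hx) y (sup_comm L.gneg L.gpos ▸ hy)

variable {L : GLSA}

theorem GLSA.op_odd (L : GLSA) : L.op.odd = L.odd := sup_comm L.gpos L.gneg

/-- A supermodule viewed over the Lie superalgebra with the opposite grading. -/
def SMod.op (M : SMod L) : SMod L.op where
  carrier := M.carrier
  act := M.act
  ev := M.ev
  od := M.od
  grading := M.grading
  act_e_ev := M.act_e_ev
  act_e_od := M.act_e_od
  act_o_ev x hx := M.act_o_ev x (L.op_odd.le hx)
  act_o_od x hx := M.act_o_od x (L.op_odd.le hx)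
  act_br_e := M.act_br_e
  act_br_oo x hx y hy := M.act_br_oo x (L.op_odd.le hx) y (L.op_odd.le hy)

/-- A supermodule over the opposite grading viewed over the original one. -/
def SMod.unop (M : SMod L.op) : SMod L where
  carrier := M.carrier
  act := M.act
  ev := M.ev
  od := M.od
  grading := M.grading
  act_e_ev := M.act_e_ev
  act_e_od := M.act_e_od
  act_o_ev x hx := M.act_o_ev x (L.op_odd.ge hx)
  act_o_od x hx := M.act_o_od x (L.op_odd.ge hx)
  act_br_e := M.act_br_e
  act_br_oo x hx y hy := M.act_br_oo x (L.op_odd.ge hx) y (L.op_odd.ge hy)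

/-- A `𝔤₀`-supermodule viewed over the Lie superalgebra with the opposite grading. -/
def SMod0.op (V : SMod0 L) : SMod0 L.op where
  carrier := V.carrier
  act := V.act
  ev := V.ev
  od := V.od
  grading := V.grading
  act_ev := V.act_ev
  act_od := V.act_od
  act_br := V.act_br

theorem IsKac'.op {V : SMod0 L} {K : SMod L} {η : V.carrier →ₗ[ℂ] K.carrier}
    (hK : IsKac' V K η) : IsKac V.op K.op η where
  map_ev := hK.map_ev
  map_od := hK.map_od
  equivar := hK.equivar
  pos_zero := hK.neg_zero
  injective := hK.injective
  generates := hK.generates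
  universal M φ h1 h2 h3 h4 := by
    obtain ⟨Φ, hΦ, huniq⟩ := hK.universal M.unop φ h1 h2 h3 h4
    refine ⟨⟨Φ.toLin, Φ.map_ev, Φ.map_od, Φ.equivar⟩, hΦ, fun Θ hΘ => ?_⟩
    have := huniq ⟨Θ.toLin, Θ.map_ev, Θ.map_od, Θ.equivar⟩ hΘ
    obtain ⟨Θ, _, _, _⟩ := Θ
    cases this
    rfl

end Opposite

/-- Let `V` be a simple `𝔤₀`-supermodule.  Then every non-zero
`𝔤`-submodule of `K(V)` contains `Λ^max(𝔤₋₁) ⊗ V`; in particular, the socle of `K(V)`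
equals `U(𝔤)·(Λ^max(𝔤₋₁) ⊗ V)` and is a simple `𝔤`-supermodule.  Similarly, the
opposite Kac module `K'(V)` has simple socle.  In particular, both `K(V)` and `K'(V)`
are indecomposable `𝔤`-supermodules. -/
theorem statement_2 (L : GLSA)
    [FiniteDimensional ℂ ↥L.gneg] [FiniteDimensional ℂ ↥L.gpos]
    (V : SMod0 L) (hV : V.IsSimple) :
    (∀ (K : SMod L) (η : V.carrier →ₗ[ℂ] K.carrier), IsKac V K η →
      (∀ N : Submodule ℂ K.carrier, K.IsSubmod N → N ≠ ⊥ → botPartNeg V K η ≤ N) ∧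
      K.socle = K.gen (botPartNeg V K η) ∧
      K.IsSimpleSub K.socle ∧
      K.Indecomposable) ∧
    (∀ (K' : SMod L) (η' : V.carrier →ₗ[ℂ] K'.carrier), IsKac' V K' η' →
      K'.IsSimpleSub K'.socle ∧ K'.Indecomposable) := by
  refine ⟨fun K η hK => ⟨fun N hN hN0 => hK.botPartNeg_le hV hN hN0,
    K.socle_of_le (hK.botPartNeg_ne_bot hV) fun N hN hN0 => hK.botPartNeg_le hV hN hN0⟩,
    fun K' η' hK' => ?_⟩
  have : FiniteDimensional ℂ L.op.gneg := ‹FiniteDimensional ℂ L.gpos›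
  have hV' : V.op.IsSimple := hV
  exact (K'.op.socle_of_le (hK'.op.botPartNeg_ne_bot hV') fun N hN hN0 =>
    hK'.op.botPartNeg_le hV' hN hN0).2
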